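/- arXiv:2009.07644 — 6 statements merged into one kernel-verified Lean document; each statement's English description precedes it below -/
import Mathlib

section
/- Let λ be a complex 4×4 matrix with rows and columns indexed by {0,1,2,3}. Suppose that for every R in the real orthogonal group O(3), writing Λ_R for the real 4×4 block-diagonal matrix diag(1, R), one has λ = Λ_R · λ · Λ_Rᵀ (componentwise, λ^{αβ} = (Λ_R)^α_ρ (Λ_R)^β_σ λ^{ρσ}). Then λ is diagonal and its three spatial diagonal entries coincide: λ = diag(λ⁰⁰, λ¹¹, λ¹¹, λ¹¹) for some λ⁰⁰, λ¹¹ ∈ ℂ. -/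
open Matrix

/-- The 4×4 real matrix `diag(1, R)` in block form, with indices `{0,1,2,3}`. -/
noncomputable def LambdaRot (R : Matrix (Fin 3) (Fin 3) ℝ) : Matrix (Fin 4) (Fin 4) ℝ :=
  Matrix.reindex finSumFinEquiv finSumFinEquiv (Matrix.fromBlocks (1 : Matrix (Fin 1) (Fin 1) ℝ) 0 0 R)

theorem LambdaRot_of (a b c d e f g h i : ℝ) :
    LambdaRot !![a, b, c; d, e, f; g, h, i] =
      !![1, 0, 0, 0; 0, a, b, c; 0, d, e, f; 0, g, h, i] := by
  ext x y
  fin_cases x <;> fin_cases y <;> rfl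

/-- Invariance under a sign flip of each of the spatial axes kills the off-diagonal entries. -/
theorem apply_eq_zero_of_invariant_signs (lam : Matrix (Fin 4) (Fin 4) ℂ)
    (h : ∀ R : Matrix (Fin 3) (Fin 3) ℝ, R ∈ Matrix.orthogonalGroup (Fin 3) ℝ →
      lam = (LambdaRot R).map (Complex.ofReal) * lam * ((LambdaRot R).map (Complex.ofReal))ᵀ)
    (i j : Fin 4) (hij : i ≠ j) : lam i j = 0 := by
  have h1 := congrFun₂ (h !![-1, 0, 0; 0, 1, 0; 0, 0, 1] (by
    rw [Matrix.mem_orthogonalGroup_iff]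
    ext x y
    fin_cases x <;> fin_cases y <;> simp [Matrix.mul_apply, Fin.sum_univ_succ])) i j
  have h2 := congrFun₂ (h !![1, 0, 0; 0, -1, 0; 0, 0, 1] (by
    rw [Matrix.mem_orthogonalGroup_iff]
    ext x y
    fin_cases x <;> fin_cases y <;> simp [Matrix.mul_apply, Fin.sum_univ_succ])) i j
  have h3 := congrFun₂ (h !![1, 0, 0; 0, 1, 0; 0, 0, -1] (by
    rw [Matrix.mem_orthogonalGroup_iff]
    ext x y
    fin_cases x <;> fin_cases y <;> simp [Matrix.mul_apply, Fin.sum_univ_succ])) i j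
  rw [LambdaRot_of] at h1 h2 h3
  fin_cases i <;> fin_cases j <;>
    simp [Matrix.mul_apply, Fin.sum_univ_four, self_eq_neg] at hij h1 h2 h3 ⊢ <;> assumption

/-- If a complex 4×4 matrix `λ` satisfies `λ = Λ_R · λ · Λ_Rᵀ` for every `R ∈ O(3)`
(where `Λ_R = diag(1,R)`), then `λ = diag(λ⁰⁰, λ¹¹, λ¹¹, λ¹¹)`. -/
theorem stmt0 (lam : Matrix (Fin 4) (Fin 4) ℂ)
    (h : ∀ R : Matrix (Fin 3) (Fin 3) ℝ, R ∈ Matrix.orthogonalGroup (Fin 3) ℝ →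
      lam = (LambdaRot R).map (Complex.ofReal) * lam * ((LambdaRot R).map (Complex.ofReal))ᵀ) :
    ∃ l00 l11 : ℂ, lam = Matrix.diagonal ![l00, l11, l11, l11] := by
  have h12 := congrFun₂ (h !![0, 1, 0; 1, 0, 0; 0, 0, 1] (by
    rw [Matrix.mem_orthogonalGroup_iff]
    ext x y
    fin_cases x <;> fin_cases y <;> simp [Matrix.mul_apply, Fin.sum_univ_succ])) 2 2
  have h13 := congrFun₂ (h !![0, 0, 1; 0, 1, 0; 1, 0, 0] (by
    rw [Matrix.mem_orthogonalGroup_iff]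
    ext x y
    fin_cases x <;> fin_cases y <;> simp [Matrix.mul_apply, Fin.sum_univ_succ])) 3 3
  rw [LambdaRot_of] at h12 h13
  simp [Matrix.mul_apply, Fin.sum_univ_four] at h12 h13
  refine ⟨lam 0 0, lam 1 1, ?_⟩
  ext i j
  rcases eq_or_ne i j with rfl | hij
  · fin_cases i <;> simp [h12, h13]
  · rw [Matrix.diagonal_apply_ne _ hij, apply_eq_zero_of_invariant_signs lam h i j hij]
end

section
/- Let f : ℝ⁴ → [0,∞] be Borel measurable. Then ∫₀^∞ ∫_{ℝ³} f(ω_m(p), p) · ω_m(p)^{-1} dp dm = ∫_{C} f(q) · ((q⁰)² − |q⃗|²)^{-1/2} dq, where ω_m(p) = √(m² + |p|²), C = {q ∈ ℝ⁴ : q⁰ > 0, (q⁰)² > |q⃗|²} is the open forward cone, dp is Lebesgue measure on ℝ³ and dq is Lebesgue measure on ℝ⁴. -/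
open MeasureTheory Set

theorem image_sqrt_sq_add_Ioi {s : ℝ} (hs : 0 ≤ s) :
    (fun m : ℝ => Real.sqrt (m ^ 2 + s)) '' Ioi 0 = {x : ℝ | 0 < x ∧ s < x ^ 2} := by
  ext x
  constructor
  · rintro ⟨m, hm, rfl⟩
    have hm : 0 < m := hm
    refine ⟨by positivity, ?_⟩
    rw [Real.sq_sqrt (by positivity)]
    nlinarith
  · rintro ⟨hx, hsx⟩
    refine ⟨Real.sqrt (x ^ 2 - s), Real.sqrt_pos.2 (by linarith), ?_⟩
    simp only
    rw [Real.sq_sqrt (by linarith), sub_add_cancel, Real.sqrt_sq hx.le]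

theorem injOn_sqrt_sq_add_Ioi {s : ℝ} (hs : 0 ≤ s) :
    InjOn (fun m : ℝ => Real.sqrt (m ^ 2 + s)) (Ioi 0) := by
  intro a ha b hb hab
  have ha : 0 < a := ha
  have hb : 0 < b := hb
  have h := (Real.sqrt_inj (by positivity) (by positivity)).1 hab
  exact (pow_left_inj₀ ha.le hb.le two_ne_zero).1 (by linarith)

theorem lintegral_Ioi_comp_sqrt_sq_add {s : ℝ} (hs : 0 ≤ s) (g : ℝ → ENNReal) :
    ∫⁻ m in Ioi (0 : ℝ), g (Real.sqrt (m ^ 2 + s)) * ENNReal.ofReal (Real.sqrt (m ^ 2 + s))⁻¹ =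
      ∫⁻ x in {x : ℝ | 0 < x ∧ s < x ^ 2}, g x * ENNReal.ofReal (Real.sqrt (x ^ 2 - s))⁻¹ := by
  have hderiv : ∀ m ∈ Ioi (0 : ℝ), HasDerivWithinAt (fun m : ℝ => Real.sqrt (m ^ 2 + s))
      (m / Real.sqrt (m ^ 2 + s)) (Ioi 0) m := by
    intro m hm
    have hm : 0 < m := hm
    have h := (((hasDerivAt_pow 2 m).add_const s).sqrt (by positivity)).hasDerivWithinAt (s := Ioi 0)
    refine h.congr_deriv ?_
    push_cast
    rw [pow_one, mul_div_mul_left _ _ two_ne_zero]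
  rw [← image_sqrt_sq_add_Ioi hs, lintegral_image_eq_lintegral_abs_deriv_mul measurableSet_Ioi
    hderiv (injOn_sqrt_sq_add_Ioi hs)]
  refine setLIntegral_congr_fun measurableSet_Ioi fun m hm => ?_
  have hm : 0 < m := hm
  rw [Real.sq_sqrt (by positivity), add_sub_cancel_right, Real.sqrt_sq hm.le,
    abs_of_pos (by positivity), mul_left_comm, ← ENNReal.ofReal_mul (by positivity)]
  congr 2
  field_simp

/-- Change of variables onto the forward cone: for Borel measurable `f : ℝ⁴ → [0,∞]`,
`∫₀^∞ ∫_{ℝ³} f(ω_m(p), p) ω_m(p)⁻¹ dp dm = ∫_C f(q) ((q⁰)² − |q⃗|²)^{-1/2} dq`,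
where `ω_m(p) = √(m² + |p|²)` and `C` is the open forward cone. -/
theorem stmt3 (f : ℝ × (Fin 3 → ℝ) → ENNReal) (hf : Measurable f) :
    (∫⁻ m in Ioi (0 : ℝ), ∫⁻ p : Fin 3 → ℝ,
        f (Real.sqrt (m ^ 2 + ∑ i, (p i) ^ 2), p) *
          ENNReal.ofReal (Real.sqrt (m ^ 2 + ∑ i, (p i) ^ 2))⁻¹ ∂volume ∂volume) =
      ∫⁻ q in {q : ℝ × (Fin 3 → ℝ) | 0 < q.1 ∧ ∑ i, (q.2 i) ^ 2 < q.1 ^ 2},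
        f q * ENNReal.ofReal (Real.sqrt (q.1 ^ 2 - ∑ i, (q.2 i) ^ 2))⁻¹ ∂volume := by
  have hcone : MeasurableSet
      {q : ℝ × (Fin 3 → ℝ) | 0 < q.1 ∧ ∑ i, (q.2 i) ^ 2 < q.1 ^ 2} := by
    rw [ofPred_and]
    exact (measurableSet_lt (by fun_prop) (by fun_prop)).inter
      (measurableSet_lt (by fun_prop) (by fun_prop))
  rw [lintegral_lintegral_swap (by fun_prop), ← lintegral_indicator hcone, Measure.volume_eq_prod,
    lintegral_prod_symm _ (Measurable.aemeasurable (Measurable.indicator (by fun_prop) hcone))]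
  refine lintegral_congr fun p => ?_
  have hslice : MeasurableSet {x : ℝ | 0 < x ∧ ∑ i, (p i) ^ 2 < x ^ 2} :=
    hcone.preimage (measurable_prodMk_right (y := p))
  rw [lintegral_Ioi_comp_sqrt_sq_add (Finset.sum_nonneg fun i _ => sq_nonneg (p i))
    fun x => f (x, p), ← lintegral_indicator hslice]
  rfl
end

section
/- Let σ₁, σ₂ : (0,∞) → ℂ be continuous, let η = diag(1,−1,−1,−1) be the Minkowski metric tensor, and let 0 < a < b. For μ, ν ∈ {0,1,2,3} and ε > 0 define g^{μν}(a,b,ε) = ∫_a^b ∫_{|p| < ε} [ η^{μν} m² σ₁(m) + (ω_m(p), p)^μ (ω_m(p), p)^ν σ₂(m) ] ω_m(p)^{-1} dp dm, where the inner integral is over the open ball of radius ε in ℝ³ with Lebesgue measure. Then lim_{ε→0⁺} ε^{-3} g^{μν}(a,b,ε) = (4π/3) ∫_a^b [ η^{μν} m σ₁(m) + δ^{μ0} δ^{ν0} m σ₂(m) ] dm, where δ is the Kronecker delta. -/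
open MeasureTheory Set Filter Topology

/-- Minkowski metric `η = diag(1,−1,−1,−1)` as a function on indices. -/
noncomputable def etaF (μ ν : Fin 4) : ℝ := if μ = ν then (if μ = 0 then 1 else -1) else 0

/-- `ω_m(p) = √(m² + |p|²)`. -/
noncomputable def omegaE (m : ℝ) (p : Fin 3 → ℝ) : ℝ := Real.sqrt (m ^ 2 + ∑ i, (p i) ^ 2)

/-- The 4-vector `(ω_m(p), p)`. -/
noncomputable def fourV (m : ℝ) (p : Fin 3 → ℝ) : Fin 4 → ℝ := Fin.cons (omegaE m p) p

/-- The Euclidean unit ball in `ℝ³` has volume `4π/3`. -/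
theorem volume_real_sum_sq_lt_one :
    (volume : Measure (Fin 3 → ℝ)).real {p | ∑ i, (p i) ^ 2 < 1} = 4 * Real.pi / 3 := by
  have h : {p : Fin 3 → ℝ | ∑ i, (p i) ^ 2 < 1} =
      WithLp.toLp 2 ⁻¹' Metric.ball (0 : EuclideanSpace ℝ (Fin 3)) 1 := by
    ext p
    simp [EuclideanSpace.norm_eq, Real.sqrt_lt' one_pos]
  rw [h, Measure.real, (PiLp.volume_preserving_toLp (Fin 3)).measure_preimage
    Metric.isOpen_ball.measurableSet.nullMeasurableSet, EuclideanSpace.volume_ball_fin_three]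
  have : 0 ≤ Real.pi * 4 / 3 := by positivity
  simp [ENNReal.toReal_ofReal this, mul_comm]

theorem sum_sq_lt_one_subset_Icc :
    {p : Fin 3 → ℝ | ∑ i, (p i) ^ 2 < 1} ⊆ Icc (-1) 1 := by
  intro p hp
  have h : ∀ i, |p i| ≤ 1 := fun i => by
    rw [← sq_le_one_iff_abs_le_one]
    exact (Finset.single_le_sum (f := fun i => (p i) ^ 2) (fun j _ => sq_nonneg _)
      (Finset.mem_univ i)).trans (le_of_lt hp)
  exact ⟨fun i => (abs_le.1 (h i)).1, fun i => (abs_le.1 (h i)).2⟩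

open scoped Pointwise in
theorem smul_sum_sq_lt_one {ε : ℝ} (hε : 0 < ε) :
    ε • {p : Fin 3 → ℝ | ∑ i, (p i) ^ 2 < 1} = {p | ∑ i, (p i) ^ 2 < ε ^ 2} := by
  ext p
  rw [Set.mem_smul_set_iff_inv_smul_mem₀ hε.ne']
  simp only [mem_ofPred_eq, Pi.smul_apply, smul_eq_mul, mul_pow, ← Finset.mul_sum, inv_pow]
  rw [inv_mul_lt_iff₀ (by positivity), mul_one]

/-- The rescaled integrals of a continuous function over balls shrinking to the origin of `ℝ³`,
integrated over a parameter, converge to `4π/3` times the integral of its values at the origin. -/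
theorem tendsto_integral_shrinking_ball {G : ℝ → (Fin 3 → ℝ) → ℂ}
    (hG : Continuous (Function.uncurry G)) (a b : ℝ) :
    Tendsto (fun ε : ℝ => ((ε : ℂ) ^ 3)⁻¹ *
        ∫ m in a..b, ∫ p in {p : Fin 3 → ℝ | ∑ i, (p i) ^ 2 < ε ^ 2}, G m p)
      (𝓝[>] 0) (𝓝 ((4 * Real.pi / 3 : ℂ) * ∫ m in a..b, G m 0)) := by
  set B : Set (Fin 3 → ℝ) := {p | ∑ i, (p i) ^ 2 < 1} with hB
  have hBm : MeasurableSet B := measurableSet_lt (by fun_prop) measurable_const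
  have hcont : Continuous fun ε : ℝ => ∫ m in a..b, ∫ p in B, G m (ε • p) := by
    apply intervalIntegral.continuous_parametric_intervalIntegral_of_continuous'
    have h := continuous_parametric_integral_of_continuous (μ := volume.restrict B)
      (f := fun (x : ℝ × ℝ) p => G x.2 (x.1 • p))
      (hG.comp (f := fun z : (ℝ × ℝ) × (Fin 3 → ℝ) => (z.1.2, z.1.1 • z.2)) (by fun_prop))
      (isCompact_Icc (a := (-1 : Fin 3 → ℝ)) (b := 1))
    rwa [Measure.restrict_restrict measurableSet_Icc,
      inter_eq_self_of_subset_right sum_sq_lt_one_subset_Icc] at h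
  have h0 : ∫ m in a..b, ∫ p in B, G m ((0 : ℝ) • p) =
      (4 * Real.pi / 3 : ℂ) * ∫ m in a..b, G m 0 := by
    simp only [zero_smul, setIntegral_const, hB, volume_real_sum_sq_lt_one,
      intervalIntegral.integral_smul]
    simp
  rw [← h0]
  refine (hcont.continuousAt.tendsto.mono_left nhdsWithin_le_nhds).congr' ?_
  filter_upwards [self_mem_nhdsWithin] with ε hε
  rw [mem_Ioi] at hε
  simp_rw [fun m => Measure.setIntegral_comp_smul_of_pos volume (G m) B hε, hB, smul_sum_sq_lt_one hε,
    intervalIntegral.integral_smul]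
  simp

theorem continuous_omegaE : Continuous (Function.uncurry omegaE) := by
  unfold omegaE Function.uncurry
  fun_prop

theorem continuous_fourV_apply (μ : Fin 4) : Continuous fun z : ℝ × (Fin 3 → ℝ) =>
    fourV z.1 z.2 μ := by
  refine Fin.cases ?_ (fun i => ?_) μ
  · simpa [fourV, Function.uncurry_def] using continuous_omegaE
  · simp only [fourV, Fin.cons_succ]
    fun_prop

theorem omegaE_pos {m : ℝ} (hm : 0 < m) (p : Fin 3 → ℝ) : 0 < omegaE m p :=
  Real.sqrt_pos.2 (by positivity)

theorem omegaE_zero {m : ℝ} (hm : 0 ≤ m) : omegaE m 0 = m := by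
  simp [omegaE, Real.sqrt_sq hm]

theorem fourV_zero {m : ℝ} (hm : 0 ≤ m) (μ : Fin 4) :
    fourV m 0 μ = if μ = 0 then m else 0 := by
  refine Fin.cases ?_ (fun i => ?_) μ
  · simp [fourV, omegaE_zero hm]
  · simp [fourV]

/-- The spectral calculus limit for causal Lorentz invariant 2-tensor valued measures:
`lim_{ε→0⁺} ε⁻³ g^{μν}(a,b,ε) = (4π/3) ∫_a^b (η^{μν} m σ₁(m) + δ^{μ0} δ^{ν0} m σ₂(m)) dm`. -/
theorem stmt4 (σ₁ σ₂ : ℝ → ℂ) (hσ₁ : ContinuousOn σ₁ (Ioi 0)) (hσ₂ : ContinuousOn σ₂ (Ioi 0))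
    (a b : ℝ) (ha : 0 < a) (hab : a < b) (μ ν : Fin 4) :
    Tendsto (fun ε : ℝ =>
        ((ε : ℂ) ^ 3)⁻¹ *
          ∫ m in a..b, ∫ p in {p : Fin 3 → ℝ | ∑ i, (p i) ^ 2 < ε ^ 2},
            ((etaF μ ν : ℂ) * (m : ℂ) ^ 2 * σ₁ m +
              (fourV m p μ : ℂ) * (fourV m p ν : ℂ) * σ₂ m) * ((omegaE m p : ℂ))⁻¹ ∂volume)
      (𝓝[>] 0)
      (𝓝 ((4 * Real.pi / 3 : ℂ) *
        ∫ m in a..b, ((etaF μ ν : ℂ) * (m : ℂ) * σ₁ m +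
          (if μ = 0 then (1 : ℂ) else 0) * (if ν = 0 then (1 : ℂ) else 0) * (m : ℂ) * σ₂ m))) := by
  set F : ℝ → (Fin 3 → ℝ) → ℂ := fun m p =>
    ((etaF μ ν : ℂ) * (m : ℂ) ^ 2 * σ₁ m + (fourV m p μ : ℂ) * (fourV m p ν : ℂ) * σ₂ m) *
      ((omegaE m p : ℂ))⁻¹ with hF
  have hpos : ∀ m : ℝ, 0 < max m a := fun m => ha.trans_le (le_max_right m a)
  have hG : Continuous (Function.uncurry fun m p => F (max m a) p) := by
    have hmax : Continuous fun z : ℝ × (Fin 3 → ℝ) => max z.1 a := by fun_prop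
    have hpair : Continuous fun z : ℝ × (Fin 3 → ℝ) => (max z.1 a, z.2) := by fun_prop
    have h₁ := hσ₁.comp_continuous hmax fun z => hpos z.1
    have h₂ := hσ₂.comp_continuous hmax fun z => hpos z.1
    have hμ := Complex.continuous_ofReal.comp ((continuous_fourV_apply μ).comp hpair)
    have hν := Complex.continuous_ofReal.comp ((continuous_fourV_apply ν).comp hpair)
    have hω := Complex.continuous_ofReal.comp (continuous_omegaE.comp hpair)
    have hη := continuous_const (y := (etaF μ ν : ℂ)) (X := ℝ × (Fin 3 → ℝ))
    exact (((hη.mul ((Complex.continuous_ofReal.comp hmax).pow 2)).mul h₁).add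
      ((hμ.mul hν).mul h₂)).mul
        (hω.inv₀ fun z => Complex.ofReal_ne_zero.2 (omegaE_pos (hpos z.1) z.2).ne')
  have hmem : ∀ m ∈ uIcc a b, a ≤ m := fun m hm => by
    rw [uIcc_of_le hab.le] at hm
    exact hm.1
  have hint : ∀ ε : ℝ,
      ∫ m in a..b, ∫ p in {p : Fin 3 → ℝ | ∑ i, (p i) ^ 2 < ε ^ 2}, F (max m a) p =
      ∫ m in a..b, ∫ p in {p : Fin 3 → ℝ | ∑ i, (p i) ^ 2 < ε ^ 2}, F m p := fun ε =>
    intervalIntegral.integral_congr fun m hm => by simp only [max_eq_left (hmem m hm)]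
  have hlim : ∫ m in a..b, F (max m a) 0 =
      ∫ m in a..b, ((etaF μ ν : ℂ) * (m : ℂ) * σ₁ m +
        (if μ = 0 then (1 : ℂ) else 0) * (if ν = 0 then (1 : ℂ) else 0) * (m : ℂ) * σ₂ m) := by
    refine intervalIntegral.integral_congr fun m hm => ?_
    have hm0 : 0 < m := ha.trans_le (hmem m hm)
    have hmc : (m : ℂ) ≠ 0 := Complex.ofReal_ne_zero.2 hm0.ne'
    simp only [hF, max_eq_left (hmem m hm), omegaE_zero hm0.le, fourV_zero hm0.le]
    split_ifs <;> push_cast <;> field_simp <;> ring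
  have key := tendsto_integral_shrinking_ball hG a b
  simp only [hint, hlim] at key
  exact key
end

section
/- Let m > 0, let Ω_m be the standard Lorentz invariant measure on the forward mass-m hyperboloid, and define for every bounded Borel Υ ⊆ ℝ⁴: Π⁰⁰(Υ) = ∫∫ χ_Υ(k + p) · Tr( γ⁰ (p̸ + m) γ⁰ (k̸ − m) ) Ω_m(dk) Ω_m(dp). For 0 < a < b and ε > 0 let Υ(a,b,ε) = { p ∈ ℝ⁴ : p⁰ > 0, a² < (p⁰)² − |p⃗|² < b², |p⃗| < ε } be the hyperbolic cylinder. Then for all 0 < a < b, lim_{ε→0⁺} ε^{-3} Π⁰⁰(Υ(a,b,ε)) = 0. -/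
open Matrix MeasureTheory Complex Filter Topology

/-- The Dirac-representation gamma matrices `γ⁰, γ¹, γ², γ³`. -/
noncomputable def gammaM : Fin 4 → Matrix (Fin 4) (Fin 4) ℂ :=
  ![!![1, 0, 0, 0; 0, 1, 0, 0; 0, 0, -1, 0; 0, 0, 0, -1],
    !![0, 0, 0, 1; 0, 0, 1, 0; 0, -1, 0, 0; -1, 0, 0, 0],
    !![0, 0, 0, -I; 0, 0, I, 0; 0, I, 0, 0; -I, 0, 0, 0],
    !![0, 0, 1, 0; 0, 0, 0, -1; -1, 0, 0, 0; 0, 1, 0, 0]]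

/-- The Feynman slash `p̸ = p⁰γ⁰ − p¹γ¹ − p²γ² − p³γ³`. -/
noncomputable def slash (p : Fin 4 → ℝ) : Matrix (Fin 4) (Fin 4) ℂ :=
  (p 0 : ℂ) • gammaM 0 - (p 1 : ℂ) • gammaM 1 - (p 2 : ℂ) • gammaM 2 - (p 3 : ℂ) • gammaM 3

/-- The standard Lorentz invariant measure `Ω_m` on the forward mass-`m` hyperboloid. -/
noncomputable def OmegaMeas (m : ℝ) : Measure (Fin 4 → ℝ) :=
  Measure.map (fun p : Fin 3 → ℝ => Fin.cons (omegaE m p) p)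
    (((volume : Measure (Fin 3 → ℝ)).restrict {p | m ≠ 0 ∨ p ≠ 0}).withDensity
      fun p => ENNReal.ofReal (omegaE m p)⁻¹)

/-- `Π⁰⁰(Υ) = ∫∫ χ_Υ(k+p) Tr(γ⁰ (p̸+m) γ⁰ (k̸−m)) Ω_m(dk) Ω_m(dp)`. -/
noncomputable def Pi00 (m : ℝ) (Υ : Set (Fin 4 → ℝ)) : ℂ :=
  ∫ p, (∫ k, Set.indicator Υ (fun _ => (1 : ℂ)) (k + p) *
      Matrix.trace (gammaM 0 * (slash p + (m : ℂ) • (1 : Matrix (Fin 4) (Fin 4) ℂ)) *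
        gammaM 0 * (slash k - (m : ℂ) • (1 : Matrix (Fin 4) (Fin 4) ℂ)))
    ∂(OmegaMeas m)) ∂(OmegaMeas m)

/-- The hyperbolic cylinder `Υ(a,b,ε) = {p : p⁰ > 0, a² < (p⁰)² − |p⃗|² < b², |p⃗| < ε}`. -/
def hypCyl (a b ε : ℝ) : Set (Fin 4 → ℝ) :=
  {p | 0 < p 0 ∧ a ^ 2 < (p 0) ^ 2 - ∑ i : Fin 3, (p i.succ) ^ 2 ∧
    (p 0) ^ 2 - ∑ i : Fin 3, (p i.succ) ^ 2 < b ^ 2 ∧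
    Real.sqrt (∑ i : Fin 3, (p i.succ) ^ 2) < ε}

lemma slash_add_smul_one (p : Fin 4 → ℝ) (c : ℂ) :
    slash p + c • (1 : Matrix (Fin 4) (Fin 4) ℂ) =
      !![p 0 + c, 0, -p 3, -p 1 + p 2 * I;
         0, p 0 + c, -p 1 - p 2 * I, p 3;
         p 3, p 1 - p 2 * I, -p 0 + c, 0;
         p 1 + p 2 * I, -p 3, 0, -p 0 + c] := by
  ext i j
  fin_cases i <;> fin_cases j <;> simp [slash, gammaM]

/-- The trace in the integrand of `Π⁰⁰` equals `4 (p⁰k⁰ + p⃗·k⃗ − m²)`. -/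
lemma trace_gamma_slash (m : ℝ) (p k : Fin 4 → ℝ) :
    Matrix.trace (gammaM 0 * (slash p + (m : ℂ) • (1 : Matrix (Fin 4) (Fin 4) ℂ)) *
        gammaM 0 * (slash k - (m : ℂ) • (1 : Matrix (Fin 4) (Fin 4) ℂ))) =
      ((4 * (p 0 * k 0 + p 1 * k 1 + p 2 * k 2 + p 3 * k 3 - m ^ 2) : ℝ) : ℂ) := by
  rw [sub_eq_add_neg (slash k), ← neg_smul, slash_add_smul_one, slash_add_smul_one]
  simp [Matrix.trace, Fin.sum_univ_four, gammaM]
  ring_nf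
  simp only [I_sq]
  ring

/-- The forward mass-`m` hyperboloid. -/
def massShell (m : ℝ) : Set (Fin 4 → ℝ) :=
  {p | 0 ≤ p 0 ∧ p 0 ^ 2 = m ^ 2 + p 1 ^ 2 + p 2 ^ 2 + p 3 ^ 2}

lemma measurableSet_massShell (m : ℝ) : MeasurableSet (massShell m) := by
  apply IsClosed.measurableSet
  apply IsClosed.inter
  · exact isClosed_le continuous_const (continuous_apply (0 : Fin 4))
  · exact isClosed_eq (f := fun p : Fin 4 → ℝ => p 0 ^ 2)
      (g := fun p : Fin 4 → ℝ => m ^ 2 + p 1 ^ 2 + p 2 ^ 2 + p 3 ^ 2) (by fun_prop) (by fun_prop)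

lemma measurable_cons_omegaE (m : ℝ) :
    Measurable (fun p : Fin 3 → ℝ => (Fin.cons (omegaE m p) p : Fin 4 → ℝ)) := by
  rw [measurable_pi_iff]
  intro i
  refine Fin.cases ?_ (fun j => ?_) i
  · simp only [Fin.cons_zero, omegaE]
    fun_prop
  · simp only [Fin.cons_succ]
    fun_prop

lemma ae_mem_massShell (m : ℝ) : ∀ᵐ p ∂(OmegaMeas m), p ∈ massShell m := by
  unfold OmegaMeas
  refine (ae_map_iff (p := (· ∈ massShell m)) (measurable_cons_omegaE m).aemeasurable
    (measurableSet_massShell m)).2 ?_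
  refine Eventually.of_forall fun p => ⟨Real.sqrt_nonneg _, ?_⟩
  change omegaE m p ^ 2 = m ^ 2 + p 0 ^ 2 + p 1 ^ 2 + p 2 ^ 2
  rw [omegaE, Real.sq_sqrt (by positivity), Fin.sum_univ_three]
  ring

/-- The energy-momenta whose momentum part lies in the closed cube of centre `c` and radius `r`. -/
def momentumCube (c : Fin 3 → ℝ) (r : ℝ) : Set (Fin 4 → ℝ) :=
  {k | ∀ i : Fin 3, |k i.succ - c i| ≤ r}

lemma measurableSet_momentumCube (c : Fin 3 → ℝ) (r : ℝ) :
    MeasurableSet (momentumCube c r) := by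
  simp only [momentumCube, Set.ofPred_forall]
  exact MeasurableSet.iInter fun i => (isClosed_le (by fun_prop) (by fun_prop)).measurableSet

lemma OmegaMeas_momentumCube_le {m : ℝ} (hm : 0 < m) (c : Fin 3 → ℝ) {r : ℝ} (hr : 0 ≤ r) :
    OmegaMeas m (momentumCube c r) ≤ ENNReal.ofReal (m⁻¹ * (2 * r) ^ 3) := by
  have hpre : (fun p : Fin 3 → ℝ => (Fin.cons (omegaE m p) p : Fin 4 → ℝ)) ⁻¹'
      momentumCube c r = Metric.closedBall c r := by
    ext p
    simp [momentumCube, dist_pi_le_iff hr, Real.dist_eq]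
  rw [OmegaMeas, Measure.map_apply (measurable_cons_omegaE m) (measurableSet_momentumCube c r),
    hpre, withDensity_apply _ measurableSet_closedBall]
  calc _ ≤ ∫⁻ _ in Metric.closedBall c r, ENNReal.ofReal m⁻¹
        ∂((volume : Measure (Fin 3 → ℝ)).restrict {p | m ≠ 0 ∨ p ≠ 0}) := by
        refine lintegral_mono fun p => ENNReal.ofReal_le_ofReal (inv_anti₀ hm ?_)
        exact Real.le_sqrt_of_sq_le (le_add_of_nonneg_right (by positivity))
    _ ≤ ENNReal.ofReal m⁻¹ * volume (Metric.closedBall c r) := by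
        rw [setLIntegral_const]
        gcongr
        exact Measure.restrict_le_self
    _ = _ := by
        rw [Real.volume_pi_closedBall c hr, ← ENNReal.ofReal_mul (by positivity), Fintype.card_fin]

lemma OmegaMeas_real_momentumCube_le {m : ℝ} (hm : 0 < m) (c : Fin 3 → ℝ) {r : ℝ} (hr : 0 ≤ r) :
    (OmegaMeas m).real (momentumCube c r) ≤ m⁻¹ * (2 * r) ^ 3 :=
  ENNReal.toReal_le_of_le_ofReal (by positivity) (OmegaMeas_momentumCube_le hm c hr)

/-- An integral is bounded by the bound of an integrand supported in a momentum cube times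
the volume of the cube. -/
lemma norm_integral_OmegaMeas_le {m : ℝ} (hm : 0 < m) (c : Fin 3 → ℝ) {r C : ℝ} (hr : 0 ≤ r)
    (hC : 0 ≤ C) {f : (Fin 4 → ℝ) → ℂ}
    (hf : ∀ k ∈ massShell m, ‖f k‖ ≤ (momentumCube c r).indicator (fun _ => C) k) :
    ‖∫ k, f k ∂(OmegaMeas m)‖ ≤ C * (m⁻¹ * (2 * r) ^ 3) := by
  have hcube := measurableSet_momentumCube c r
  have hfin : OmegaMeas m (momentumCube c r) ≠ ⊤ :=
    ((OmegaMeas_momentumCube_le hm c hr).trans_lt ENNReal.ofReal_lt_top).ne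
  have hint : Integrable ((momentumCube c r).indicator (fun _ => C)) (OmegaMeas m) :=
    (integrable_indicator_iff hcube).2 (integrableOn_const hfin)
  refine (norm_integral_le_of_norm_le hint ((ae_mem_massShell m).mono hf)).trans ?_
  rw [integral_indicator_const _ hcube, smul_eq_mul, mul_comm]
  gcongr
  exact OmegaMeas_real_momentumCube_le hm c hr

lemma abs_massShell_pairing_le {m : ℝ} {p k : Fin 4 → ℝ} (hp : p ∈ massShell m)
    (hk : k ∈ massShell m) :
    |p 0 * k 0 + p 1 * k 1 + p 2 * k 2 + p 3 * k 3 - m ^ 2| ≤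
      ((k 1 + p 1) ^ 2 + (k 2 + p 2) ^ 2 + (k 3 + p 3) ^ 2) / 2 := by
  obtain ⟨hp0, hp⟩ := hp
  obtain ⟨hk0, hk⟩ := hk
  have hsq : (m ^ 2 - (p 1 * k 1 + p 2 * k 2 + p 3 * k 3)) ^ 2 ≤ (p 0 * k 0) ^ 2 := by
    rw [mul_pow, hp, hk]
    have h := mul_nonneg (sq_nonneg m) (add_nonneg (add_nonneg (sq_nonneg (k 1 + p 1))
      (sq_nonneg (k 2 + p 2))) (sq_nonneg (k 3 + p 3)))
    linarith [sq_nonneg (p 1 * k 2 - p 2 * k 1), sq_nonneg (p 1 * k 3 - p 3 * k 1),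
      sq_nonneg (p 2 * k 3 - p 3 * k 2)]
  have hle := (abs_le_of_sq_le_sq' hsq (mul_nonneg hp0 hk0)).2
  rw [abs_le]
  constructor
  · have : 0 ≤ ((k 1 + p 1) ^ 2 + (k 2 + p 2) ^ 2 + (k 3 + p 3) ^ 2) / 2 := by positivity
    linarith
  · linarith [sq_nonneg (p 0 - k 0)]

lemma sum_sq_lt_of_mem_hypCyl {a b ε : ℝ} {q : Fin 4 → ℝ} (hq : q ∈ hypCyl a b ε) :
    q 1 ^ 2 + q 2 ^ 2 + q 3 ^ 2 < ε ^ 2 := by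
  have h := hq.2.2.2
  have hε : 0 < ε := (Real.sqrt_nonneg _).trans_lt h
  rw [Real.sqrt_lt' hε, Fin.sum_univ_three] at h
  exact h

lemma abs_succ_le_of_mem_hypCyl {a b ε : ℝ} (hε : 0 < ε) {q : Fin 4 → ℝ}
    (hq : q ∈ hypCyl a b ε) (i : Fin 3) : |q i.succ| ≤ ε := by
  have h := sum_sq_lt_of_mem_hypCyl hq
  refine abs_le_of_sq_le_sq ?_ hε.le
  fin_cases i
  · change q 1 ^ 2 ≤ ε ^ 2
    nlinarith
  · change q 2 ^ 2 ≤ ε ^ 2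
    nlinarith
  · change q 3 ^ 2 ≤ ε ^ 2
    nlinarith

lemma zero_le_of_mem_hypCyl {a b ε : ℝ} (hb : 0 < b) (hε : 0 < ε) (hε1 : ε ≤ 1)
    {q : Fin 4 → ℝ} (hq : q ∈ hypCyl a b ε) : q 0 ≤ b + 1 := by
  have h := sum_sq_lt_of_mem_hypCyl hq
  have h2 := hq.2.2.1
  rw [Fin.sum_univ_three] at h2
  change q 0 ^ 2 - (q 1 ^ 2 + q 2 ^ 2 + q 3 ^ 2) < b ^ 2 at h2
  nlinarith [hq.1]

lemma abs_succ_le_zero_of_mem_massShell {m : ℝ} {p : Fin 4 → ℝ} (hp : p ∈ massShell m)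
    (i : Fin 3) : |p i.succ| ≤ p 0 := by
  refine abs_le_of_sq_le_sq ?_ hp.1
  rw [hp.2]
  fin_cases i
  · change p 1 ^ 2 ≤ _
    nlinarith
  · change p 2 ^ 2 ≤ _
    nlinarith
  · change p 3 ^ 2 ≤ _
    nlinarith

lemma norm_Pi00_hypCyl_le {m a b ε : ℝ} (hm : 0 < m) (hb : 0 < b) (hε : 0 < ε) (hε1 : ε ≤ 1) :
    ‖Pi00 m (hypCyl a b ε)‖ ≤
      2 * ε ^ 2 * (m⁻¹ * (2 * ε) ^ 3) * (m⁻¹ * (2 * (b + 1)) ^ 3) := by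
  refine norm_integral_OmegaMeas_le hm 0 (by positivity) (by positivity) fun p hp => ?_
  by_cases hpc : p ∈ momentumCube 0 (b + 1)
  · rw [Set.indicator_of_mem hpc]
    refine norm_integral_OmegaMeas_le hm (fun i => -p i.succ) hε.le (by positivity)
      fun k hk => ?_
    by_cases hq : k + p ∈ hypCyl a b ε
    · have hkc : k ∈ momentumCube (fun i => -p i.succ) ε := fun i => by
        simpa using abs_succ_le_of_mem_hypCyl hε hq i
      have h1 := abs_massShell_pairing_le hp hk
      have h2 := sum_sq_lt_of_mem_hypCyl hq
      simp only [Pi.add_apply] at h2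
      rw [Set.indicator_of_mem hq, Set.indicator_of_mem hkc, one_mul, trace_gamma_slash,
        norm_real, Real.norm_eq_abs, abs_mul, abs_of_pos (by norm_num : (0 : ℝ) < 4)]
      linarith
    · rw [Set.indicator_of_notMem hq, zero_mul, norm_zero]
      exact Set.indicator_nonneg (fun _ _ => by positivity) _
  · rw [Set.indicator_of_notMem hpc, integral_eq_zero_of_ae, norm_zero]
    filter_upwards [ae_mem_massShell m] with k hk
    have hq : k + p ∉ hypCyl a b ε := fun hq => hpc fun i => by
      have h := zero_le_of_mem_hypCyl hb hε hε1 hq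
      simp only [Pi.add_apply] at h
      have h3 := abs_succ_le_zero_of_mem_massShell hp i
      simp only [Pi.zero_apply, sub_zero]
      linarith [hk.1]
    simp [Set.indicator_of_notMem hq]

/-- For all `0 < a < b`, `lim_{ε→0⁺} ε⁻³ Π⁰⁰(Υ(a,b,ε)) = 0`. -/
theorem stmt10 (m : ℝ) (hm : 0 < m) (a b : ℝ) (ha : 0 < a) (hab : a < b) :
    Tendsto (fun ε : ℝ => ((ε : ℂ) ^ 3)⁻¹ * Pi00 m (hypCyl a b ε)) (𝓝[>] 0) (𝓝 0) := by
  have hlim : Tendsto (fun ε : ℝ => 16 * m⁻¹ * (m⁻¹ * (2 * (b + 1)) ^ 3) * ε ^ 2)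
      (𝓝[>] 0) (𝓝 0) := by
    refine tendsto_nhdsWithin_of_tendsto_nhds (Continuous.tendsto' (by fun_prop) _ _ (by simp))
  refine squeeze_zero_norm' ?_ hlim
  filter_upwards [Ioc_mem_nhdsGT (zero_lt_one : (0 : ℝ) < 1)] with ε hε
  have h := norm_Pi00_hypCyl_le (a := a) hm (ha.trans hab) hε.1 hε.2
  have hε3 : 0 < ε ^ 3 := pow_pos hε.1 3
  rw [norm_mul, norm_inv, norm_pow, norm_real, Real.norm_eq_abs, abs_of_pos hε.1,
    inv_mul_le_iff₀ hε3]
  refine h.trans_eq ?_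
  ring
end

section
/- Let m > 0, e ∈ ℝ, and let iΣ(Υ) = (e²/(16π²)) ∫∫ χ_Υ(p + k) (4m·I₄ − 2 p̸) Ω_m(dp) Ω₀(dk) for bounded Borel Υ ⊆ ℝ⁴. For m ≤ a < b and ε > 0 let Υ(a,b,ε) = { p ∈ ℝ⁴ : p⁰ > 0, a² < (p⁰)² − |p⃗|² < b², |p⃗| < ε }, and let Z₁(c) = (c² − m²)/(2c) for c ≥ m. Then lim_{ε→0⁺} ε^{-3} iΣ(Υ(a,b,ε)) = (4π/3) · (e²/(16π²)) · ∫_{Z₁(a)}^{Z₁(b)} 4π ( 4m·I₄ − 2 ω_m(r) γ⁰ ) ω_m(r)^{-1} r dr, where ω_m(r) = √(m² + r²). -/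
open Matrix MeasureTheory Complex Filter Topology

/-- The electron self-energy matrix valued measure
`iΣ(Υ) = (e²/(16π²)) ∫∫ χ_Υ(p+k) (4m·I₄ − 2p̸) Ω_m(dp) Ω₀(dk)`. -/
noncomputable def iSigma (m e : ℝ) (Υ : Set (Fin 4 → ℝ)) : Matrix (Fin 4) (Fin 4) ℂ :=
  Matrix.of fun i j =>
    ((e ^ 2 / (16 * Real.pi ^ 2) : ℝ) : ℂ) *
      ∫ k, (∫ p, Set.indicator Υ (fun _ => (1 : ℂ)) (p + k) *
          (((4 * (m : ℂ)) • (1 : Matrix (Fin 4) (Fin 4) ℂ) - (2 : ℂ) • slash p) i j)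
        ∂(OmegaMeas m)) ∂(OmegaMeas 0)

/-- `Z₁(c) = (c² − m²)/(2c)`. -/
noncomputable def Z1 (m c : ℝ) : ℝ := (c ^ 2 - m ^ 2) / (2 * c)

/-- Three-momentum space with its Euclidean norm. -/
abbrev Momentum := EuclideanSpace ℝ (Fin 3)

/-- The relativistic energy `√(m² + |p|²)` of a three-momentum. -/
noncomputable def energy (m : ℝ) (p : Momentum) : ℝ := Real.sqrt (m ^ 2 + ‖p‖ ^ 2)

theorem continuous_energy (m : ℝ) : Continuous (energy m) := by
  unfold energy; fun_prop

theorem energy_pos {m : ℝ} (hm : 0 < m) (p : Momentum) : 0 < energy m p := by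
  unfold energy; positivity

theorem energy_nonneg (m : ℝ) (p : Momentum) : 0 ≤ energy m p :=
  Real.sqrt_nonneg _

theorem energy_zero_mass (p : Momentum) : energy 0 p = ‖p‖ := by
  simp [energy]

theorem norm_le_energy (m : ℝ) (p : Momentum) : ‖p‖ ≤ energy m p :=
  Real.le_sqrt_of_sq_le (by nlinarith [sq_nonneg m])

theorem energy_neg (m : ℝ) (p : Momentum) : energy m (-p) = energy m p := by
  simp [energy]

theorem sum_sq_eq_norm_sq (p : Momentum) : ∑ i, (p i) ^ 2 = ‖p‖ ^ 2 := by
  rw [EuclideanSpace.norm_sq_eq]; simp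

theorem omegaE_ofLp (m : ℝ) (p : Momentum) : omegaE m p.ofLp = energy m p := by
  rw [omegaE, energy, sum_sq_eq_norm_sq]

theorem measurableEmbedding_massShell (m : ℝ) :
    MeasurableEmbedding
      (fun p : Fin 3 → ℝ => (Fin.cons (omegaE m p) p : Fin 4 → ℝ)) := by
  refine Continuous.measurableEmbedding ?_ fun p q h => ?_
  · refine continuous_pi fun i => ?_
    refine Fin.cases ?_ (fun i => ?_) i
    · simp only [Fin.cons_zero, omegaE]; fun_prop
    · simp only [Fin.cons_succ]; fun_prop
  · exact (Fin.cons_inj.mp h).2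

theorem integral_OmegaMeas (m : ℝ) (f : (Fin 4 → ℝ) → ℂ) :
    ∫ x, f x ∂(OmegaMeas m) =
      ∫ p : Momentum, (energy m p)⁻¹ • f (Fin.cons (energy m p) p.ofLp) := by
  have hnull : (volume : Measure (Fin 3 → ℝ)).restrict {p | m ≠ 0 ∨ p ≠ 0} = volume := by
    refine Measure.restrict_eq_self_of_ae_mem ?_
    filter_upwards [compl_mem_ae_iff.mpr (measure_singleton (0 : Fin 3 → ℝ))] with p hp
    exact Or.inr hp
  have hmeas : Measurable fun p : Fin 3 → ℝ => ENNReal.ofReal (omegaE m p)⁻¹ := by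
    unfold omegaE; fun_prop
  rw [OmegaMeas, (measurableEmbedding_massShell m).integral_map, hnull,
    integral_withDensity_eq_integral_toReal_smul hmeas (by simp),
    ← (PiLp.volume_preserving_ofLp (Fin 3)).integral_comp
      (MeasurableEquiv.toLp 2 (Fin 3 → ℝ)).symm.measurableEmbedding]
  refine integral_congr_ae (Eventually.of_forall fun p => ?_)
  simp only [omegaE_ofLp]
  rw [ENNReal.toReal_ofReal (inv_nonneg.mpr (energy_nonneg m p))]

/-- The integrand of the rescaled self-energy measure of the hyperbolic cylinder. -/
noncomputable def scaledKernel (m a b : ℝ) (G : Momentum → ℂ) (ε : ℝ) (k u : Momentum) : ℂ :=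
  open Classical in
  if ‖u‖ < 1 ∧ a ^ 2 < (energy m (ε • u - k) + ‖k‖) ^ 2 - ‖ε • u‖ ^ 2 ∧
      (energy m (ε • u - k) + ‖k‖) ^ 2 - ‖ε • u‖ ^ 2 < b ^ 2
    then G (ε • u - k) else 0

theorem stronglyMeasurable_scaledKernel (m a b : ℝ) {G : Momentum → ℂ} (hG : Continuous G)
    (ε : ℝ) : StronglyMeasurable (Function.uncurry (scaledKernel m a b G ε)) := by
  have := continuous_energy m
  refine StronglyMeasurable.ite ?_ (Continuous.stronglyMeasurable (by fun_prop))
    stronglyMeasurable_const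
  refine MeasurableSet.inter (measurableSet_lt (f := fun x : Momentum × Momentum => ‖x.2‖) ?_ ?_)
    (MeasurableSet.inter
      (measurableSet_lt (g := fun x : Momentum × Momentum =>
        (energy m (ε • x.2 - x.1) + ‖x.1‖) ^ 2 - ‖ε • x.2‖ ^ 2) ?_ ?_)
      (measurableSet_lt (f := fun x : Momentum × Momentum =>
        (energy m (ε • x.2 - x.1) + ‖x.1‖) ^ 2 - ‖ε • x.2‖ ^ 2) ?_ ?_)) <;>
  · refine Continuous.measurable ?_
    fun_prop

theorem norm_scaledKernel_le {m a b C : ℝ} (hb : 0 ≤ b) {G : Momentum → ℂ}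
    (hC : ∀ p, ‖G p‖ ≤ C) {ε : ℝ} (hε : 0 < ε) (hε1 : ε ≤ 1) (k u : Momentum) :
    ‖scaledKernel m a b G ε k u‖ ≤
      (Metric.closedBall (0 : Momentum) (b + 1)).indicator (fun _ => C) k *
        (Metric.ball (0 : Momentum) 1).indicator (fun _ => (1 : ℝ)) u := by
  have hC0 : 0 ≤ C := (norm_nonneg _).trans (hC 0)
  unfold scaledKernel
  split_ifs with h
  · obtain ⟨h1, -, h3⟩ := h
    have hu : u ∈ Metric.ball (0 : Momentum) 1 := by simpa using h1
    have hk : k ∈ Metric.closedBall (0 : Momentum) (b + 1) := by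
      rw [mem_closedBall_zero_iff]
      have h4 : ‖ε • u‖ ≤ 1 := by
        rw [norm_smul, Real.norm_of_nonneg hε.le]
        nlinarith [norm_nonneg u]
      have h5 := (norm_nonneg _).trans (norm_le_energy m (ε • u - k))
      by_contra! h6
      nlinarith [norm_nonneg (ε • u), norm_nonneg k]
    simpa [hu, hk] using hC _
  · rw [norm_zero]
    refine mul_nonneg (Set.indicator_nonneg (fun _ _ => hC0) _)
      (Set.indicator_nonneg (fun _ _ => zero_le_one) _)

theorem integrable_indicator_ball_one :
    Integrable ((Metric.ball (0 : Momentum) 1).indicator (fun _ => (1 : ℝ))) :=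
  (integrable_indicator_iff measurableSet_ball).mpr
    (integrableOn_const measure_ball_lt_top.ne)

theorem volume_real_ball_one : volume.real (Metric.ball (0 : Momentum) 1) = 4 * Real.pi / 3 := by
  rw [Measure.real, EuclideanSpace.volume_ball_fin_three, ENNReal.ofReal_one, one_pow,
    one_mul, ENNReal.toReal_ofReal (by positivity)]
  ring

theorem integrable_indicator_inv_norm (R : ℝ) :
    Integrable (fun k : Momentum =>
      (Metric.closedBall (0 : Momentum) R).indicator (fun k => ‖k‖⁻¹) k) := by
  have h : (fun k : Momentum => (Metric.closedBall (0 : Momentum) R).indicator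
      (fun k => ‖k‖⁻¹) k) = fun k => (Set.Iic R).indicator (fun r : ℝ => r⁻¹) ‖k‖ := by
    ext k
    by_cases hk : ‖k‖ ≤ R
    · rw [Set.indicator_of_mem (mem_closedBall_zero_iff.mpr hk), Set.indicator_of_mem (Set.mem_Iic.mpr hk)]
    · rw [Set.indicator_of_notMem (fun h => hk (mem_closedBall_zero_iff.mp h)),
        Set.indicator_of_notMem (fun h => hk (Set.mem_Iic.mp h))]
  rw [h, integrable_fun_norm_addHaar volume (f := (Set.Iic R).indicator (fun r : ℝ => r⁻¹))]
  have h2 : IntegrableOn (fun y : ℝ => y) (Set.Ioc 0 R) :=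
    continuous_id.integrableOn_Ioc
  rw [← integrable_indicator_iff measurableSet_Ioc] at h2
  refine (integrableOn_congr_fun ?_ measurableSet_Ioi).mpr h2.integrableOn
  intro y hy
  have hy : 0 < y := hy
  by_cases hyR : y ≤ R
  · simp [hyR, hy, pow_two]
  · simp [hyR, hy]

/-- The momenta `k` for which the massive and massless particles of opposite momenta `-k` and `k`
have total energy between `a` and `b`. -/
def decayRegion (m a b : ℝ) : Set Momentum :=
  {k | a < energy m k + ‖k‖ ∧ energy m k + ‖k‖ < b}

/-- Away from the boundary of the decay region, the rescaled kernel converges pointwise. -/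
theorem tendsto_scaledKernel {m a b : ℝ} (ha : 0 < a) (hb : 0 < b) {G : Momentum → ℂ}
    (hG : Continuous G) {k : Momentum} (hka : energy m k + ‖k‖ ≠ a)
    (hkb : energy m k + ‖k‖ ≠ b) (u : Momentum) :
    Tendsto (fun ε => scaledKernel m a b G ε k u) (𝓝[>] 0)
      (𝓝 ((Metric.ball (0 : Momentum) 1).indicator (fun _ => (1 : ℝ)) u •
        (decayRegion m a b).indicator (fun k => G (-k)) k)) := by
  refine Tendsto.mono_left ?_ nhdsWithin_le_nhds
  have hs : 0 ≤ energy m k + ‖k‖ := add_nonneg (Real.sqrt_nonneg _) (norm_nonneg _)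
  have hcont : Continuous fun ε : ℝ => (energy m (ε • u - k) + ‖k‖) ^ 2 - ‖ε • u‖ ^ 2 := by
    have := continuous_energy m
    fun_prop
  have hlim := hcont.tendsto 0
  simp only [zero_smul, zero_sub, energy_neg, norm_zero] at hlim
  have hlimG : Tendsto (fun ε : ℝ => G (ε • u - k)) (𝓝 0) (𝓝 (G (-k))) := by
    have : Continuous fun ε : ℝ => G (ε • u - k) := by fun_prop
    simpa using this.tendsto 0
  by_cases hu : ‖u‖ < 1
  swap
  · have : ∀ ε, scaledKernel m a b G ε k u = 0 := fun ε => if_neg fun h => hu h.1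
    simp [this, hu]
  have hu' : u ∈ Metric.ball (0 : Momentum) 1 := by simpa using hu
  rw [Set.indicator_of_mem hu', one_smul]
  rcases lt_or_gt_of_ne hka with h | h
  · rw [Set.indicator_of_notMem (fun hk => absurd hk.1 h.not_gt)]
    refine tendsto_const_nhds.congr' ?_
    filter_upwards [hlim.eventually_lt_const (u := a ^ 2) (by nlinarith)] with ε hε
    exact (if_neg fun h => absurd h.2.1 hε.not_gt).symm
  rcases lt_or_gt_of_ne hkb with h' | h'
  · rw [Set.indicator_of_mem (show k ∈ decayRegion m a b from ⟨h, h'⟩)]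
    refine hlimG.congr' ?_
    filter_upwards [hlim.eventually_lt_const (u := b ^ 2) (by nlinarith),
      hlim.eventually_const_lt (u := a ^ 2) (by nlinarith)] with ε hε hε'
    exact (if_pos ⟨hu, hε', hε⟩).symm
  · rw [Set.indicator_of_notMem (fun hk => absurd hk.2 h'.not_gt)]
    refine tendsto_const_nhds.congr' ?_
    filter_upwards [hlim.eventually_const_lt (u := b ^ 2) (by nlinarith)] with ε hε
    exact (if_neg fun h => absurd h.2.2 hε.not_gt).symm

theorem norm_eq_Z1_of_energy_add_norm_eq {m c : ℝ} (hc : 0 < c) {k : Momentum}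
    (h : energy m k + ‖k‖ = c) : ‖k‖ = Z1 m c := by
  have h1 : energy m k ^ 2 = m ^ 2 + ‖k‖ ^ 2 := Real.sq_sqrt (by positivity)
  have h2 : energy m k = c - ‖k‖ := by linarith
  rw [Z1, eq_div_iff (by positivity)]
  rw [h2] at h1
  linarith

theorem ae_energy_add_norm_ne (m : ℝ) {c : ℝ} (hc : 0 < c) :
    ∀ᵐ k : Momentum, energy m k + ‖k‖ ≠ c := by
  filter_upwards [compl_mem_ae_iff.mpr
    (Measure.addHaar_sphere volume (0 : Momentum) (Z1 m c))] with k hk h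
  exact hk (mem_sphere_zero_iff_norm.mpr (norm_eq_Z1_of_energy_add_norm_eq hc h))

/-- The rescaled self-energy integral converges to an integral over the decay region. -/
theorem tendsto_integral_scaledKernel {m a b C : ℝ} (ha : 0 < a) (hb : 0 < b)
    {G : Momentum → ℂ} (hG : Continuous G) (hC : ∀ p, ‖G p‖ ≤ C) :
    Tendsto (fun ε => ∫ k : Momentum, ‖k‖⁻¹ • ∫ u, scaledKernel m a b G ε k u) (𝓝[>] 0)
      (𝓝 (∫ k : Momentum, ‖k‖⁻¹ • ((4 * Real.pi / 3 : ℝ) •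
        (decayRegion m a b).indicator (fun k => G (-k)) k))) := by
  have hε : ∀ᶠ ε : ℝ in 𝓝[>] 0, 0 < ε ∧ ε ≤ 1 := by
    filter_upwards [Ioc_mem_nhdsGT (zero_lt_one' ℝ)] with ε hε using hε
  have hint : ∫ u, (Metric.ball (0 : Momentum) 1).indicator (fun _ => (1 : ℝ)) u =
      4 * Real.pi / 3 := by
    rw [integral_indicator measurableSet_ball, setIntegral_const, volume_real_ball_one]
    simp
  refine tendsto_integral_filter_of_dominated_convergence
    (fun k => C * (4 * Real.pi / 3) *
      (Metric.closedBall (0 : Momentum) (b + 1)).indicator (fun k => ‖k‖⁻¹) k)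
    (Eventually.of_forall fun ε => ?_) ?_ ((integrable_indicator_inv_norm (b + 1)).const_mul _) ?_
  · refine AEStronglyMeasurable.smul (f := fun k : Momentum => ‖k‖⁻¹)
      (by fun_prop) ?_
    exact (stronglyMeasurable_scaledKernel m a b hG ε).integral_prod_right.aestronglyMeasurable
  · filter_upwards [hε] with ε hε
    refine Eventually.of_forall fun k => ?_
    have h := norm_integral_le_of_norm_le (integrable_indicator_ball_one.const_mul _)
      (Eventually.of_forall (norm_scaledKernel_le (m := m) (a := a) hb.le hC hε.1 hε.2 k))
    rw [integral_const_mul, hint] at h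
    rw [norm_smul, norm_inv, norm_norm]
    refine (mul_le_mul_of_nonneg_left h (by positivity)).trans_eq ?_
    by_cases hk : k ∈ Metric.closedBall (0 : Momentum) (b + 1)
    · simp only [Set.indicator_of_mem hk]; ring
    · simp only [Set.indicator_of_notMem hk]; ring
  · filter_upwards [ae_energy_add_norm_ne m ha, ae_energy_add_norm_ne m hb] with k hka hkb
    refine Tendsto.const_smul ?_ _
    rw [← hint, ← integral_smul_const]
    refine tendsto_integral_filter_of_dominated_convergence _ (Eventually.of_forall fun ε => ?_)
      (hε.mono fun ε hε => Eventually.of_forall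
        (norm_scaledKernel_le (m := m) (a := a) hb.le hC hε.1 hε.2 k))
      (integrable_indicator_ball_one.const_mul _)
      (Eventually.of_forall (tendsto_scaledKernel ha hb hG hka hkb))
    exact ((stronglyMeasurable_scaledKernel m a b hG ε).comp_measurable
      measurable_prodMk_left).aestronglyMeasurable

theorem massShell_add_lightCone_mem_hypCyl {m : ℝ} (hm : 0 < m) (a b ε : ℝ) (p k : Momentum) :
    (Fin.cons (energy m p) p.ofLp + Fin.cons ‖k‖ k.ofLp : Fin 4 → ℝ) ∈ hypCyl a b ε ↔
      ‖p + k‖ < ε ∧ a ^ 2 < (energy m p + ‖k‖) ^ 2 - ‖p + k‖ ^ 2 ∧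
        (energy m p + ‖k‖) ^ 2 - ‖p + k‖ ^ 2 < b ^ 2 := by
  have h : ∑ i : Fin 3, (p i + k i) ^ 2 = ‖p + k‖ ^ 2 := by
    rw [← sum_sq_eq_norm_sq]; simp
  have h0 : 0 < energy m p + ‖k‖ := add_pos_of_pos_of_nonneg (energy_pos hm p) (norm_nonneg k)
  simp only [hypCyl, Set.mem_ofPred_eq, Pi.add_apply, Fin.cons_zero, Fin.cons_succ, h,
    Real.sqrt_sq (norm_nonneg _), h0, true_and]
  tauto

/-- The entries of `(4m - 2p̸) / ω_m(p)` on the mass shell. -/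
noncomputable def selfEnergyDensity (m : ℝ) (i j : Fin 4) (p : Momentum) : ℂ :=
  (energy m p)⁻¹ • (((4 * (m : ℂ)) • (1 : Matrix (Fin 4) (Fin 4) ℂ) -
    (2 : ℂ) • slash (Fin.cons (energy m p) p.ofLp)) i j)

theorem iSigma_hypCyl_eq {m : ℝ} (hm : 0 < m) (e a b : ℝ) {ε : ℝ} (hε : 0 < ε) (i j : Fin 4) :
    iSigma m e (hypCyl a b ε) i j = ((e ^ 2 / (16 * Real.pi ^ 2) : ℝ) : ℂ) * ((ε : ℂ) ^ 3 *
      ∫ k : Momentum, ‖k‖⁻¹ • ∫ u, scaledKernel m a b (selfEnergyDensity m i j) ε k u) := by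
  simp only [iSigma, of_apply, integral_OmegaMeas, energy_zero_mass]
  congr 1
  rw [← integral_const_mul]
  refine integral_congr_ae (Eventually.of_forall fun k => ?_)
  simp only
  rw [mul_smul_comm]
  congr 1
  rw [← integral_sub_right_eq_self _ k]
  have hscale := Measure.integral_comp_smul (volume : Measure Momentum)
    (fun q => (energy m (q - k))⁻¹ •
      ((hypCyl a b ε).indicator (fun _ => (1 : ℂ))
        (Fin.cons (energy m (q - k)) (q - k).ofLp + Fin.cons ‖k‖ k.ofLp) *
      (((4 * (m : ℂ)) • (1 : Matrix (Fin 4) (Fin 4) ℂ) -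
        (2 : ℂ) • slash (Fin.cons (energy m (q - k)) (q - k).ofLp)) i j))) ε
  rw [finrank_euclideanSpace_fin, abs_of_pos (by positivity), eq_inv_smul_iff₀ (by positivity)]
    at hscale
  rw [← hscale, Complex.real_smul]
  push_cast
  congr 1
  refine integral_congr_ae (Eventually.of_forall fun u => ?_)
  have hu : ‖ε • u‖ < ε ↔ ‖u‖ < 1 := by
    rw [norm_smul, Real.norm_of_nonneg hε.le, mul_lt_iff_lt_one_right hε]
  have hmem := massShell_add_lightCone_mem_hypCyl hm a b ε (ε • u - k) k
  rw [sub_add_cancel, hu] at hmem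
  unfold scaledKernel selfEnergyDensity
  simp only
  split_ifs with h
  · rw [Set.indicator_of_mem (hmem.mpr h), one_mul]
  · rw [Set.indicator_of_notMem (fun h' => h (hmem.mp h')), zero_mul, smul_zero]

/-- The part of the self-energy density that depends on the momentum only through its norm. -/
noncomputable def radialDensity (m : ℝ) (i j : Fin 4) (r : ℝ) : ℂ :=
  ((Real.sqrt (m ^ 2 + r ^ 2) : ℝ) : ℂ)⁻¹ *
    (((4 * (m : ℂ)) • (1 : Matrix (Fin 4) (Fin 4) ℂ) -
      (2 * (Real.sqrt (m ^ 2 + r ^ 2) : ℝ) : ℂ) • gammaM 0) i j)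

/-- The part of the self-energy density that is odd in the momentum. -/
noncomputable def oddDensity (m : ℝ) (i j : Fin 4) (p : Momentum) : ℂ :=
  2 * ∑ l : Fin 3, (((energy m p)⁻¹ * p l : ℝ) : ℂ) * gammaM l.succ i j

theorem selfEnergyDensity_eq (m : ℝ) (i j : Fin 4) (p : Momentum) :
    selfEnergyDensity m i j p = radialDensity m i j ‖p‖ + oddDensity m i j p := by
  have hr : Real.sqrt (m ^ 2 + ‖p‖ ^ 2) = energy m p := rfl
  simp only [selfEnergyDensity, radialDensity, oddDensity, hr, slash, Complex.real_smul,
    Fin.sum_univ_three, Matrix.sub_apply, Matrix.smul_apply, smul_eq_mul, Fin.cons_zero]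
  have h1 : (Fin.cons (energy m p) p.ofLp : Fin 4 → ℝ) 1 = p 0 := rfl
  have h2 : (Fin.cons (energy m p) p.ofLp : Fin 4 → ℝ) 2 = p 1 := rfl
  have h3 : (Fin.cons (energy m p) p.ofLp : Fin 4 → ℝ) 3 = p 2 := rfl
  have e1 : (Fin.succ 0 : Fin 4) = 1 := rfl
  have e2 : (Fin.succ 1 : Fin 4) = 2 := rfl
  have e3 : (Fin.succ 2 : Fin 4) = 3 := rfl
  rw [h1, h2, h3, e1, e2, e3]
  push_cast
  ring

theorem continuous_radialDensity {m : ℝ} (hm : 0 < m) (i j : Fin 4) :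
    Continuous (radialDensity m i j) := by
  unfold radialDensity
  simp only [Matrix.sub_apply, Matrix.smul_apply, smul_eq_mul]
  refine Continuous.mul (Continuous.inv₀ (by fun_prop) fun r => ?_) (by fun_prop)
  exact Complex.ofReal_ne_zero.mpr (by positivity)

theorem continuous_oddDensity {m : ℝ} (hm : 0 < m) (i j : Fin 4) :
    Continuous (oddDensity m i j) := by
  have h : Continuous fun p => (energy m p)⁻¹ :=
    (continuous_energy m).inv₀ fun p => (energy_pos hm p).ne'
  unfold oddDensity
  fun_prop

theorem oddDensity_neg (m : ℝ) (i j : Fin 4) (p : Momentum) :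
    oddDensity m i j (-p) = -oddDensity m i j p := by
  simp [oddDensity, energy_neg, Finset.sum_neg_distrib]

theorem exists_norm_radialDensity_le {m : ℝ} (hm : 0 < m) (i j : Fin 4) :
    ∃ C, ∀ r, ‖radialDensity m i j r‖ ≤ C := by
  refine ⟨4 * ‖(1 : Matrix (Fin 4) (Fin 4) ℂ) i j‖ + 2 * ‖gammaM 0 i j‖, fun r => ?_⟩
  have hω : 0 < Real.sqrt (m ^ 2 + r ^ 2) := by positivity
  have hmω : m ≤ Real.sqrt (m ^ 2 + r ^ 2) := Real.le_sqrt_of_sq_le (by nlinarith [sq_nonneg r])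
  have hω' : ((Real.sqrt (m ^ 2 + r ^ 2) : ℝ) : ℂ) ≠ 0 := Complex.ofReal_ne_zero.mpr hω.ne'
  have h : radialDensity m i j r =
      ((m / Real.sqrt (m ^ 2 + r ^ 2) : ℝ) : ℂ) * (4 * (1 : Matrix (Fin 4) (Fin 4) ℂ) i j) -
        2 * gammaM 0 i j := by
    simp only [radialDensity, Matrix.sub_apply, Matrix.smul_apply, smul_eq_mul]
    push_cast
    field_simp
  rw [h]
  refine (norm_sub_le _ _).trans (add_le_add ?_ (by simp))
  rw [norm_mul, Complex.norm_real, Real.norm_of_nonneg (by positivity)]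
  refine (mul_le_of_le_one_left (norm_nonneg _) ((div_le_one hω).mpr hmω)).trans_eq ?_
  rw [norm_mul, Complex.norm_ofNat]

theorem exists_norm_oddDensity_le {m : ℝ} (hm : 0 < m) (i j : Fin 4) :
    ∃ C, ∀ p, ‖oddDensity m i j p‖ ≤ C := by
  refine ⟨2 * ∑ l : Fin 3, ‖gammaM l.succ i j‖, fun p => ?_⟩
  rw [oddDensity, norm_mul, Complex.norm_ofNat]
  refine mul_le_mul_of_nonneg_left (norm_sum_le_of_le _ fun l _ => ?_) zero_le_two
  rw [norm_mul, Complex.norm_real, norm_mul, norm_inv, Real.norm_of_nonneg (energy_nonneg m p)]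
  refine mul_le_of_le_one_left (norm_nonneg _) ?_
  rw [inv_mul_le_one₀ (energy_pos hm p)]
  exact (PiLp.norm_apply_le p l).trans (norm_le_energy m p)

theorem measurableSet_decayRegion (m a b : ℝ) : MeasurableSet (decayRegion m a b) := by
  have := continuous_energy m
  have h : Measurable fun k : Momentum => energy m k + ‖k‖ :=
    Continuous.measurable (by fun_prop)
  exact (measurableSet_lt measurable_const h).inter (measurableSet_lt h measurable_const)

theorem neg_mem_decayRegion {m a b : ℝ} {k : Momentum} :
    -k ∈ decayRegion m a b ↔ k ∈ decayRegion m a b := by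
  simp [decayRegion, energy_neg]

theorem integrable_inv_norm_smul_indicator_decayRegion (m a b : ℝ) {C : ℝ} {H : Momentum → ℂ}
    (hH : Continuous H) (hC : ∀ p, ‖H p‖ ≤ C) :
    Integrable fun k : Momentum => ‖k‖⁻¹ • (decayRegion m a b).indicator H k := by
  refine Integrable.mono' ((integrable_indicator_inv_norm b).const_mul C) ?_
    (Eventually.of_forall fun k => ?_)
  · refine AEStronglyMeasurable.smul (f := fun k : Momentum => ‖k‖⁻¹) (by fun_prop) ?_
    exact hH.aestronglyMeasurable.indicator (measurableSet_decayRegion m a b)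
  · have hC0 : 0 ≤ C := (norm_nonneg _).trans (hC 0)
    by_cases hk : k ∈ decayRegion m a b
    · have hkb : k ∈ Metric.closedBall (0 : Momentum) b := by
        rw [mem_closedBall_zero_iff]
        linarith [hk.2, energy_nonneg m k]
      rw [Set.indicator_of_mem hk, Set.indicator_of_mem hkb, norm_smul, norm_inv, norm_norm,
        mul_comm]
      exact mul_le_mul_of_nonneg_right (hC k) (by positivity)
    · rw [Set.indicator_of_notMem hk, smul_zero, norm_zero]
      exact mul_nonneg hC0 (Set.indicator_nonneg (fun _ _ => by positivity) _)

theorem integral_odd_decayRegion (m a b : ℝ) {H : Momentum → ℂ} (hH : ∀ p, H (-p) = -H p) :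
    ∫ k : Momentum, ‖k‖⁻¹ • (decayRegion m a b).indicator H k = 0 := by
  have h := integral_neg_eq_self
    (fun k : Momentum => ‖k‖⁻¹ • (decayRegion m a b).indicator H k) volume
  have h2 : ∀ k : Momentum, ‖-k‖⁻¹ • (decayRegion m a b).indicator H (-k) =
      -(‖k‖⁻¹ • (decayRegion m a b).indicator H k) := by
    intro k
    by_cases hk : k ∈ decayRegion m a b
    · rw [Set.indicator_of_mem hk, Set.indicator_of_mem (neg_mem_decayRegion.mpr hk), hH,
        norm_neg, smul_neg]
    · rw [Set.indicator_of_notMem hk,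
        Set.indicator_of_notMem (fun h => hk (neg_mem_decayRegion.mp h)), smul_zero, smul_zero,
        neg_zero]
  simp only [h2, integral_neg] at h
  exact self_eq_neg.mp h.symm

theorem Z1_lt_iff {m c : ℝ} (hm : 0 < m) (hc : 0 < c) {r : ℝ} :
    Z1 m c < r ↔ c < Real.sqrt (m ^ 2 + r ^ 2) + r := by
  rw [Z1, div_lt_iff₀ (by positivity), ← sub_lt_iff_lt_add]
  rcases le_or_gt c r with h | h
  · refine iff_of_true (by nlinarith [sq_pos_of_pos hm]) ?_
    exact lt_of_le_of_lt (by linarith : c - r ≤ 0) (by positivity)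
  · rw [Real.lt_sqrt (by linarith)]
    constructor <;> intro h <;> nlinarith

theorem lt_Z1_iff {m c : ℝ} (hm : 0 < m) (hc : 0 < c) {r : ℝ} :
    r < Z1 m c ↔ Real.sqrt (m ^ 2 + r ^ 2) + r < c := by
  rw [Z1, lt_div_iff₀ (by positivity), ← lt_sub_iff_add_lt]
  rcases le_or_gt c r with h | h
  · refine iff_of_false (by nlinarith [sq_pos_of_pos hm]) (not_lt.mpr ?_)
    exact (by linarith : c - r ≤ 0).trans (by positivity)
  · rw [Real.sqrt_lt' (by linarith)]
    constructor <;> intro h <;> nlinarith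

theorem Z1_nonneg {m c : ℝ} (hm : 0 < m) (hc : m ≤ c) : 0 ≤ Z1 m c :=
  div_nonneg (by nlinarith) (by linarith)

theorem Z1_le_Z1 {m a b : ℝ} (hm : 0 < m) (ha : m ≤ a) (hab : a ≤ b) : Z1 m a ≤ Z1 m b := by
  have ha0 : 0 < a := hm.trans_le ha
  have hb0 : 0 < b := ha0.trans_le hab
  rw [Z1, Z1, div_le_div_iff₀ (by positivity) (by positivity)]
  nlinarith [mul_nonneg (sub_nonneg.mpr hab) (mul_pos ha0 hb0).le,
    mul_nonneg (sub_nonneg.mpr hab) (sq_nonneg m)]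

theorem integral_radial_decayRegion {m a b : ℝ} (hm : 0 < m) (ha : m ≤ a) (hab : a < b)
    (g : ℝ → ℂ) :
    ∫ k : Momentum, ‖k‖⁻¹ • (decayRegion m a b).indicator (fun k => g ‖k‖) k =
      ∫ r in (Z1 m a)..(Z1 m b), ((4 * Real.pi : ℝ) : ℂ) * (g r * r) := by
  have ha0 : 0 < a := hm.trans_le ha
  have hb0 : 0 < b := ha0.trans hab
  have hmem : ∀ k : Momentum, k ∈ decayRegion m a b ↔ ‖k‖ ∈ Set.Ioo (Z1 m a) (Z1 m b) := by
    intro k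
    rw [Set.mem_Ioo, Z1_lt_iff hm ha0, lt_Z1_iff hm hb0]
    rfl
  have h : (fun k : Momentum => ‖k‖⁻¹ • (decayRegion m a b).indicator (fun k => g ‖k‖) k) =
      fun k => (Set.Ioo (Z1 m a) (Z1 m b)).indicator (fun r : ℝ => r⁻¹ • g r) ‖k‖ := by
    ext k
    by_cases hk : k ∈ decayRegion m a b
    · rw [Set.indicator_of_mem hk, Set.indicator_of_mem ((hmem k).mp hk)]
    · rw [Set.indicator_of_notMem hk, Set.indicator_of_notMem (fun h => hk ((hmem k).mpr h)),
        smul_zero]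
  rw [h, integral_fun_norm_addHaar volume
      ((Set.Ioo (Z1 m a) (Z1 m b)).indicator (fun r : ℝ => r⁻¹ • g r)),
    intervalIntegral.integral_of_le (Z1_le_Z1 hm ha hab.le), integral_Ioc_eq_integral_Ioo,
    integral_const_mul, finrank_euclideanSpace_fin, volume_real_ball_one]
  have hsub : Set.Ioo (Z1 m a) (Z1 m b) ⊆ Set.Ioi 0 := fun r hr => (Z1_nonneg hm ha).trans_lt hr.1
  have h2 : ∫ y in Set.Ioi (0 : ℝ),
      y ^ (3 - 1) • (Set.Ioo (Z1 m a) (Z1 m b)).indicator (fun r : ℝ => r⁻¹ • g r) y =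
      ∫ r in Set.Ioo (Z1 m a) (Z1 m b), g r * r := by
    rw [← Set.inter_eq_self_of_subset_right hsub, ← setIntegral_indicator measurableSet_Ioo]
    refine setIntegral_congr_fun measurableSet_Ioi fun y hy => ?_
    have hy0 : (y : ℂ) ≠ 0 := Complex.ofReal_ne_zero.mpr (ne_of_gt hy)
    rw [Set.inter_eq_self_of_subset_right hsub]
    by_cases hyI : y ∈ Set.Ioo (Z1 m a) (Z1 m b)
    · simp only [Set.indicator_of_mem hyI, Complex.real_smul]
      push_cast
      field_simp
    · simp only [Set.indicator_of_notMem hyI, smul_zero]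
  rw [h2, Complex.real_smul, nsmul_eq_mul]
  push_cast
  ring

theorem integral_selfEnergyDensity_decayRegion {m a b : ℝ} (hm : 0 < m) (ha : m ≤ a)
    (hab : a < b) (i j : Fin 4) :
    ∫ k : Momentum, ‖k‖⁻¹ • (decayRegion m a b).indicator
        (fun k => selfEnergyDensity m i j (-k)) k =
      ∫ r in (Z1 m a)..(Z1 m b), ((4 * Real.pi : ℝ) : ℂ) * (radialDensity m i j r * r) := by
  obtain ⟨C₁, hC₁⟩ := exists_norm_radialDensity_le hm i j
  obtain ⟨C₂, hC₂⟩ := exists_norm_oddDensity_le hm i j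
  have hsplit : (fun k => selfEnergyDensity m i j (-k)) =
      (fun k : Momentum => radialDensity m i j ‖k‖) + fun k => -oddDensity m i j k := by
    ext k
    simp [selfEnergyDensity_eq, oddDensity_neg]
  simp only [hsplit, Set.indicator_add', Pi.add_apply, smul_add]
  rw [integral_add
    (integrable_inv_norm_smul_indicator_decayRegion m a b
      (H := fun p => radialDensity m i j ‖p‖)
      ((continuous_radialDensity hm i j).comp continuous_norm) fun p => hC₁ ‖p‖)
    (integrable_inv_norm_smul_indicator_decayRegion m a b
      (H := fun p => -oddDensity m i j p) (continuous_oddDensity hm i j).neg fun p => (norm_neg _).trans_le (hC₂ p)),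
    integral_odd_decayRegion m a b (H := fun p => -oddDensity m i j p)
      (fun p => by rw [oddDensity_neg]),
    add_zero, integral_radial_decayRegion hm ha hab]

/-- The spectral calculus limit for the electron self-energy measure:
`lim_{ε→0⁺} ε⁻³ iΣ(Υ(a,b,ε)) = (4π/3)(e²/(16π²)) ∫_{Z₁(a)}^{Z₁(b)} 4π(4m·I₄ − 2ω_m(r)γ⁰) ω_m(r)⁻¹ r dr`. -/
theorem stmt13 (m : ℝ) (hm : 0 < m) (e : ℝ) (a b : ℝ) (ha : m ≤ a) (hab : a < b) :
    Tendsto (fun ε : ℝ => ((ε : ℂ) ^ 3)⁻¹ • iSigma m e (hypCyl a b ε)) (𝓝[>] 0)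
      (𝓝 (((4 * Real.pi / 3) * (e ^ 2 / (16 * Real.pi ^ 2)) : ℝ) •
        (Matrix.of fun i j =>
          ∫ r in (Z1 m a)..(Z1 m b),
            ((4 * Real.pi : ℝ) : ℂ) *
              (((4 * (m : ℂ)) • (1 : Matrix (Fin 4) (Fin 4) ℂ) -
                (2 * (Real.sqrt (m ^ 2 + r ^ 2) : ℝ) : ℂ) • gammaM 0) i j) *
              ((Real.sqrt (m ^ 2 + r ^ 2) : ℝ) : ℂ)⁻¹ * (r : ℂ)))) := by
  have ha0 : 0 < a := hm.trans_le ha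
  refine tendsto_pi_nhds.mpr fun i => tendsto_pi_nhds.mpr fun j => ?_
  obtain ⟨C₁, hC₁⟩ := exists_norm_radialDensity_le hm i j
  obtain ⟨C₂, hC₂⟩ := exists_norm_oddDensity_le hm i j
  have heq : selfEnergyDensity m i j =
      fun p => radialDensity m i j ‖p‖ + oddDensity m i j p :=
    funext (selfEnergyDensity_eq m i j)
  have hcont : Continuous (selfEnergyDensity m i j) := by
    rw [heq]
    exact ((continuous_radialDensity hm i j).comp continuous_norm).add
      (continuous_oddDensity hm i j)
  have hbound : ∀ p, ‖selfEnergyDensity m i j p‖ ≤ C₁ + C₂ := fun p => by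
    rw [heq]
    exact (norm_add_le _ _).trans (add_le_add (hC₁ _) (hC₂ p))
  have hlim := (tendsto_integral_scaledKernel (m := m) ha0 (ha0.trans hab) hcont hbound).const_mul
    ((e ^ 2 / (16 * Real.pi ^ 2) : ℝ) : ℂ)
  simp only [smul_comm _ (4 * Real.pi / 3 : ℝ)] at hlim
  rw [integral_smul, integral_selfEnergyDensity_decayRegion hm ha hab] at hlim
  have htarget : (((4 * Real.pi / 3) * (e ^ 2 / (16 * Real.pi ^ 2)) : ℝ) •
        (Matrix.of fun i j =>
          ∫ r in (Z1 m a)..(Z1 m b),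
            ((4 * Real.pi : ℝ) : ℂ) *
              (((4 * (m : ℂ)) • (1 : Matrix (Fin 4) (Fin 4) ℂ) -
                (2 * (Real.sqrt (m ^ 2 + r ^ 2) : ℝ) : ℂ) • gammaM 0) i j) *
              ((Real.sqrt (m ^ 2 + r ^ 2) : ℝ) : ℂ)⁻¹ * (r : ℂ))) i j =
      ((e ^ 2 / (16 * Real.pi ^ 2) : ℝ) : ℂ) * ((4 * Real.pi / 3 : ℝ) •
        ∫ r in (Z1 m a)..(Z1 m b), ((4 * Real.pi : ℝ) : ℂ) * (radialDensity m i j r * r)) := by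
    rw [Matrix.smul_apply, of_apply, Complex.real_smul, Complex.real_smul, Complex.ofReal_mul,
      mul_comm (((4 * Real.pi / 3 : ℝ) : ℂ)), mul_assoc]
    congr 2
    refine intervalIntegral.integral_congr fun r _ => ?_
    simp only [radialDensity]
    ring
  rw [htarget]
  refine hlim.congr' ?_
  filter_upwards [self_mem_nhdsWithin] with ε hε
  have hε : 0 < ε := hε
  have hε0 : (ε : ℂ) ≠ 0 := Complex.ofReal_ne_zero.mpr hε.ne'
  rw [Matrix.smul_apply, iSigma_hypCyl_eq hm e a b hε, smul_eq_mul]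
  field_simp
end

section
/- Let κ be an invertible complex 4×4 matrix and Λ a real 4×4 matrix with Λᵀ η Λ = η such that κ p̸ κ^{-1} = (Λp)̸ for all p ∈ ℝ⁴. Let ψ : ℝ⁴ → ℂ⁴ be continuously differentiable, define (κ·ψ)(x) = κ ψ(Λ^{-1}x), and define the Dirac operator (∂̸ψ)(x) = γ⁰ ∂₀ψ(x) + γ¹ ∂₁ψ(x) + γ² ∂₂ψ(x) + γ³ ∂₃ψ(x), where ∂_μ is the partial derivative in the x^μ coordinate. Then κ·(∂̸ψ) = ∂̸(κ·ψ). -/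
open Matrix Complex

/-- Minkowski metric `η = diag(1,−1,−1,−1)` as a real 4×4 matrix. -/
noncomputable def etaM : Matrix (Fin 4) (Fin 4) ℝ := Matrix.diagonal ![1, -1, -1, -1]

/-- The partial derivative `∂_μ ψ(x)` in the `x^μ` coordinate. -/
noncomputable def pd (ψ : (Fin 4 → ℝ) → (Fin 4 → ℂ)) (μ : Fin 4) (x : Fin 4 → ℝ) : Fin 4 → ℂ :=
  fderiv ℝ ψ x (Pi.single μ 1)

/-- The Dirac operator `(∂̸ψ)(x) = γ⁰∂₀ψ(x) + γ¹∂₁ψ(x) + γ²∂₂ψ(x) + γ³∂₃ψ(x)`. -/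
noncomputable def diracSlash (ψ : (Fin 4 → ℝ) → (Fin 4 → ℂ)) (x : Fin 4 → ℝ) : Fin 4 → ℂ :=
  (gammaM 0).mulVec (pd ψ 0 x) + (gammaM 1).mulVec (pd ψ 1 x) +
    (gammaM 2).mulVec (pd ψ 2 x) + (gammaM 3).mulVec (pd ψ 3 x)

theorem etaM_mul_etaM : etaM * etaM = 1 := by
  rw [etaM, diagonal_mul_diagonal, ← diagonal_one]
  congr 1
  ext i
  fin_cases i <;> simp

theorem etaM_transpose : etaMᵀ = etaM := diagonal_transpose _

theorem slash_eq_sum (p : Fin 4 → ℝ) :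
    slash p = ∑ μ, (((etaM *ᵥ p) μ : ℝ) : ℂ) • gammaM μ := by
  simp [slash, etaM, mulVec_diagonal, Fin.sum_univ_four, sub_eq_add_neg]

theorem diracSlash_eq_sum (ψ : (Fin 4 → ℝ) → (Fin 4 → ℂ)) (x : Fin 4 → ℝ) :
    diracSlash ψ x = ∑ μ, gammaM μ *ᵥ pd ψ μ x := by
  rw [diracSlash, Fin.sum_univ_four]

theorem inv_eq_of_lorentz {Λ : Matrix (Fin 4) (Fin 4) ℝ} (hΛ : Λᵀ * etaM * Λ = etaM) :
    Λ⁻¹ = etaM * Λᵀ * etaM := by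
  apply inv_eq_left_inv
  rw [mul_assoc etaM, mul_assoc etaM, hΛ, etaM_mul_etaM]

theorem slash_etaM_mulVec_single (ν : Fin 4) :
    slash (etaM *ᵥ Pi.single ν 1) = gammaM ν := by
  rw [slash_eq_sum, mulVec_mulVec, etaM_mul_etaM, one_mulVec,
    Finset.sum_eq_single ν (fun μ _ h => by simp [h]) (by simp)]
  simp

theorem mul_gammaM {κ : Matrix (Fin 4) (Fin 4) ℂ} (hκ : IsUnit κ)
    {Λ : Matrix (Fin 4) (Fin 4) ℝ} (hΛ : Λᵀ * etaM * Λ = etaM)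
    (hslash : ∀ p : Fin 4 → ℝ, κ * slash p * κ⁻¹ = slash (Λ *ᵥ p)) (ν : Fin 4) :
    κ * gammaM ν = ∑ μ, Λ⁻¹ ν μ • (gammaM μ * κ) := by
  have hdet : IsUnit κ.det := (isUnit_iff_isUnit_det κ).1 hκ
  have htr : etaM * Λ * etaM = (Λ⁻¹)ᵀ := by
    simp [inv_eq_of_lorentz hΛ, etaM_transpose, mul_assoc]
  have h := hslash (etaM *ᵥ Pi.single ν 1)
  rw [slash_etaM_mulVec_single, slash_eq_sum, mulVec_mulVec, mulVec_mulVec, htr] at h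
  rw [← nonsing_inv_mul_cancel_right κ (κ * gammaM ν) hdet, h, Finset.sum_mul]
  simp

theorem pd_mulVec_comp_mulVec (κ : Matrix (Fin 4) (Fin 4) ℂ) (M : Matrix (Fin 4) (Fin 4) ℝ)
    {ψ : (Fin 4 → ℝ) → (Fin 4 → ℂ)} (hψ : Differentiable ℝ ψ) (μ : Fin 4) (x : Fin 4 → ℝ) :
    pd (fun y => κ *ᵥ ψ (M *ᵥ y)) μ x = ∑ ν, M ν μ • κ *ᵥ pd ψ ν (M *ᵥ x) := by
  let K : (Fin 4 → ℂ) →L[ℝ] (Fin 4 → ℂ) :=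
    LinearMap.toContinuousLinearMap (κ.mulVecLin.restrictScalars ℝ)
  let L : (Fin 4 → ℝ) →L[ℝ] (Fin 4 → ℝ) := LinearMap.toContinuousLinearMap M.mulVecLin
  have h : HasFDerivAt (fun y => κ *ᵥ ψ (M *ᵥ y)) (K.comp ((fderiv ℝ ψ (M *ᵥ x)).comp L)) x :=
    K.hasFDerivAt.comp x
      (HasFDerivAt.comp x (f := L) (hψ (M *ᵥ x)).hasFDerivAt L.hasFDerivAt)
  have hcol : M *ᵥ Pi.single μ 1 = ∑ ν, M ν μ • Pi.single ν (1 : ℝ) := by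
    rw [mulVec_single_one]
    exact pi_eq_sum_univ' _
  rw [pd, h.fderiv]
  change K (fderiv ℝ ψ (M *ᵥ x) (M *ᵥ Pi.single μ 1)) = _
  rw [hcol, map_sum, map_sum]
  simp only [map_smul]
  rfl

/-- Intertwining of the Dirac operator with the action `(κ·ψ)(x) = κ ψ(Λ⁻¹x)`:
`κ·(∂̸ψ) = ∂̸(κ·ψ)`. -/
theorem stmt16 (κ : Matrix (Fin 4) (Fin 4) ℂ) (hκ : IsUnit κ)
    (Λ : Matrix (Fin 4) (Fin 4) ℝ) (hΛ : Λᵀ * etaM * Λ = etaM)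
    (hslash : ∀ p : Fin 4 → ℝ, κ * slash p * κ⁻¹ = slash (Λ.mulVec p))
    (ψ : (Fin 4 → ℝ) → (Fin 4 → ℂ)) (hψ : ContDiff ℝ 1 ψ) :
    ∀ x : Fin 4 → ℝ,
      κ.mulVec (diracSlash ψ (Λ⁻¹.mulVec x)) =
        diracSlash (fun y => κ.mulVec (ψ (Λ⁻¹.mulVec y))) x := by
  intro x
  have hd : Differentiable ℝ ψ := hψ.differentiable one_ne_zero
  simp only [diracSlash_eq_sum, pd_mulVec_comp_mulVec κ Λ⁻¹ hd, mulVec_sum, mulVec_mulVec,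
    mulVec_smul, mul_gammaM hκ hΛ hslash, sum_mulVec, smul_mulVec]
  exact Finset.sum_comm
end
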